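/- arXiv:2312.14374 — 4 statements merged into one kernel-verified Lean document; each statement's English description precedes it below -/
import Mathlib

section
/- Let θ be a substitution whose domain contains no variable occurring in any of the terms t₁, …, tₙ. Then for every term s, ρ(θ)(ρ(s)) = ρ(θ(s)); that is, performing the replacement of u by c(t₁, …, tₙ) on both the substitution and the term and then applying the substitution yields the same term as first applying the substitution and then performing the replacement. -/
inductive FOTerm (F : Type) (V : Type) : Type where
  | var : V → FOTerm F V
  | app : F → List (FOTerm F V) → FOTerm F V

namespace FOTerm

variable {F V : Type}

/-- Application of a substitution to a term. -/
def subst (θ : V → FOTerm F V) : FOTerm F V → FOTerm F V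
  | .var x => θ x
  | .app f ts => .app f (ts.attach.map fun ⟨t, _⟩ => subst θ t)

/-- Replacement `ρ`: replace every occurrence of the nullary symbol `u` by `c(tl)`. -/
def replace [DecidableEq F] (u c : F) (tl : List (FOTerm F V)) : FOTerm F V → FOTerm F V
  | .var x => .var x
  | .app f [] => if f = u then .app c tl else .app f []
  | .app f ts => .app f (ts.attach.map fun ⟨t, _⟩ => replace u c tl t)

/-- Inversion `ι`: replace every outermost subterm headed by `c` by the constant `u`. -/
def invert [DecidableEq F] (u c : F) : FOTerm F V → FOTerm F V
  | .var x => .var x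
  | .app f ts => if f = c then .app u [] else .app f (ts.attach.map fun ⟨t, _⟩ => invert u c t)

/-- The variable `x` occurs in a term. -/
inductive OccursVar (x : V) : FOTerm F V → Prop
  | var : OccursVar x (.var x)
  | app {f : F} {ts : List (FOTerm F V)} {t : FOTerm F V} :
      t ∈ ts → OccursVar x t → OccursVar x (.app f ts)

/-- The function symbol `g` occurs (as head of some subterm) in a term. -/
inductive OccursFn (g : F) : FOTerm F V → Prop
  | head {ts : List (FOTerm F V)} : OccursFn g (.app g ts)
  | arg {f : F} {ts : List (FOTerm F V)} {t : FOTerm F V} :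
      t ∈ ts → OccursFn g t → OccursFn g (.app f ts)

/-- The domain of a substitution: the variables it moves. -/
def domain (θ : V → FOTerm F V) : Set V := {x | θ x ≠ FOTerm.var x}

/-- A substitution is a map from variables to terms moving only finitely many variables. -/
def IsSubst (θ : V → FOTerm F V) : Prop := (domain θ).Finite

/-- `ρ` extended to substitutions. -/
def replaceSubst [DecidableEq F] (u c : F) (tl : List (FOTerm F V))
    (θ : V → FOTerm F V) : V → FOTerm F V := fun x => replace u c tl (θ x)

/-- `ι` extended to substitutions. -/
def invertSubst [DecidableEq F] (u c : F) (θ : V → FOTerm F V) : V → FOTerm F V :=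
  fun x => invert u c (θ x)

/-- Apply a term transformation to both components of every pair of a unification problem. -/
def mapProb (g : FOTerm F V → FOTerm F V) (U : Set (FOTerm F V × FOTerm F V)) :
    Set (FOTerm F V × FOTerm F V) := (fun p => (g p.1, g p.2)) '' U

/-- `θ` unifies the unification problem `U`. -/
def Unifies (θ : V → FOTerm F V) (U : Set (FOTerm F V × FOTerm F V)) : Prop :=
  ∀ p ∈ U, subst θ p.1 = subst θ p.2

/-- `U` is unifiable. -/
def Unifiable (U : Set (FOTerm F V × FOTerm F V)) : Prop :=
  ∃ θ, IsSubst θ ∧ Unifies θ U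

end FOTerm

namespace FOTerm

theorem subst_app {F V : Type} (θ : V → FOTerm F V) (f : F) (ts : List (FOTerm F V)) :
    subst θ (.app f ts) = .app f (ts.map (subst θ)) := by
  simp [subst]

theorem replace_app_nil {F V : Type} [DecidableEq F] (u c : F) (tl : List (FOTerm F V)) (f : F) :
    replace u c tl (.app f []) = if f = u then .app c tl else .app f [] := by
  simp [replace]

theorem replace_app_cons {F V : Type} [DecidableEq F] (u c : F) (tl : List (FOTerm F V)) (f : F)
    (t : FOTerm F V) (ts : List (FOTerm F V)) :
    replace u c tl (.app f (t :: ts)) = .app f ((t :: ts).map (replace u c tl)) := by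
  simp [replace]

@[elab_as_elim]
theorem inductionOn {F V : Type} {motive : FOTerm F V → Prop} (s : FOTerm F V)
    (var : ∀ x, motive (.var x))
    (app : ∀ f ts, (∀ t ∈ ts, motive t) → motive (.app f ts)) : motive s :=
  match s with
  | .var x => var x
  | .app f ts => app f ts fun t _ => inductionOn t var app

/-- A substitution fixing every variable that occurs in a term fixes the term. -/
theorem subst_eq_self {F V : Type} {θ : V → FOTerm F V} {s : FOTerm F V}
    (h : ∀ x, OccursVar x s → θ x = .var x) : subst θ s = s := by
  induction s using inductionOn with
  | var x => simpa [subst] using h x .var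
  | app f ts ih =>
    rw [subst_app, List.map_congr_left (g := id) fun t ht =>
      ih t ht fun x hx => h x (.app ht hx), List.map_id]

end FOTerm

/-- Let `θ` be a substitution whose domain contains no variable
occurring in any of the terms `t₁, …, tₙ` (the list `tl`).  Then for every term `s`,
`ρ(θ)(ρ(s)) = ρ(θ(s))`, where `ρ` replaces the constant `u` by `c(t₁, …, tₙ)`. -/
theorem replace_subst_distrib_term {F V : Type} [DecidableEq F]
    (u c : F) (tl : List (FOTerm F V)) (θ : V → FOTerm F V)
    (hθ : FOTerm.IsSubst θ)
    (hdom : ∀ x ∈ FOTerm.domain θ, ∀ t ∈ tl, ¬ FOTerm.OccursVar x t) :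
    ∀ s : FOTerm F V,
      FOTerm.subst (FOTerm.replaceSubst u c tl θ) (FOTerm.replace u c tl s)
        = FOTerm.replace u c tl (FOTerm.subst θ s) := by
  have htl : ∀ t ∈ tl, FOTerm.subst (FOTerm.replaceSubst u c tl θ) t = t := by
    refine fun t ht => FOTerm.subst_eq_self fun x hx => ?_
    have hx' : θ x = .var x := by
      by_contra hne
      exact hdom x hne t ht hx
    simp [FOTerm.replaceSubst, hx', FOTerm.replace]
  intro s
  induction s using FOTerm.inductionOn with
  | var x => simp [FOTerm.replace, FOTerm.subst, FOTerm.replaceSubst]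
  | app f ts ih =>
    cases ts with
    | nil =>
      rw [FOTerm.subst_app, List.map_nil, FOTerm.replace_app_nil]
      split_ifs
      · rw [FOTerm.subst_app, List.map_congr_left (g := id) htl, List.map_id]
      · rw [FOTerm.subst_app, List.map_nil]
    | cons t ts =>
      rw [FOTerm.subst_app, List.map_cons, FOTerm.replace_app_cons, FOTerm.replace_app_cons,
        FOTerm.subst_app, ← List.map_cons, List.map_map, List.map_map]
      exact congrArg _ (List.map_congr_left ih)
end

section
/- Let θ be a substitution whose domain contains no variable occurring in any of the terms t₁, …, tₙ. Then for every first-order formula F over the signature, ρ(θ)(ρ(F)) = ρ(θ(F)), where formulas are identified up to consistent capture-avoiding renaming of bound variables. -/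
/-- Terms in a locally-nameless representation: free variables `fvar` (the
variables of the signature), bound variables `bvar` (de Bruijn indices, used
for the quantified variables of formulas), and applications of function
symbols to lists of argument terms. -/
inductive Tm (F V : Type) : Type where
  | fvar : V → Tm F V
  | bvar : ℕ → Tm F V
  | app : F → List (Tm F V) → Tm F V

namespace Tm

variable {F V : Type}

/-- A term is locally closed: it is a genuine first-order term over the
signature, containing no (dangling) bound variables. -/
inductive LC : Tm F V → Prop
  | fvar (x : V) : LC (.fvar x)
  | app {f : F} {ts : List (Tm F V)} : (∀ t ∈ ts, LC t) → LC (.app f ts)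

/-- Application of a substitution to a term. -/
def subst (θ : V → Tm F V) : Tm F V → Tm F V
  | .fvar x => θ x
  | .bvar n => .bvar n
  | .app f ts => .app f (ts.attach.map fun ⟨t, _⟩ => subst θ t)

/-- Replacement `ρ`: replace every occurrence of the nullary symbol `u` by
`c(tl)`. -/
def replace [DecidableEq F] (u c : F) (tl : List (Tm F V)) : Tm F V → Tm F V
  | .fvar x => .fvar x
  | .bvar n => .bvar n
  | .app f [] => if f = u then .app c tl else .app f []
  | .app f ts => .app f (ts.attach.map fun ⟨t, _⟩ => replace u c tl t)

/-- The variable `x` occurs in a term. -/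
inductive OccursVar (x : V) : Tm F V → Prop
  | fvar : OccursVar x (.fvar x)
  | app {f : F} {ts : List (Tm F V)} {t : Tm F V} :
      t ∈ ts → OccursVar x t → OccursVar x (.app f ts)

/-- The domain of a substitution: the variables it moves. -/
def domain (θ : V → Tm F V) : Set V := {x | θ x ≠ Tm.fvar x}

/-- A substitution moves only finitely many variables. -/
def IsSubst (θ : V → Tm F V) : Prop := (domain θ).Finite

/-- `ρ` extended to substitutions. -/
def replaceSubst [DecidableEq F] (u c : F) (tl : List (Tm F V))
    (θ : V → Tm F V) : V → Tm F V := fun x => replace u c tl (θ x)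

end Tm

/-- First-order formulas over the signature `F` of function symbols and the
relation symbols `R`, built from atomic formulas, `⊤`, `⊥`, the connectives
`∧`, `∨`, `⊃`, and the quantifiers `∀` and `∃`.  Quantifiers are represented in
de Bruijn style, so that formulas that differ only by a consistent
capture-avoiding renaming of bound variables are literally equal. -/
inductive Fm (F R V : Type) : Type where
  | atom : R → List (Tm F V) → Fm F R V
  | top : Fm F R V
  | bot : Fm F R V
  | and : Fm F R V → Fm F R V → Fm F R V
  | or : Fm F R V → Fm F R V → Fm F R V
  | imp : Fm F R V → Fm F R V → Fm F R V
  | all : Fm F R V → Fm F R V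
  | ex : Fm F R V → Fm F R V

namespace Fm

variable {F R V : Type}

/-- Capture-avoiding application of a substitution to the free variables of a
formula (capture cannot occur since substitutions map variables to locally
closed terms, while bound variables are de Bruijn indices). -/
def subst (θ : V → Tm F V) : Fm F R V → Fm F R V
  | .atom r ts => .atom r (ts.map (Tm.subst θ))
  | .top => .top
  | .bot => .bot
  | .and a b => .and (subst θ a) (subst θ b)
  | .or a b => .or (subst θ a) (subst θ b)
  | .imp a b => .imp (subst θ a) (subst θ b)
  | .all a => .all (subst θ a)
  | .ex a => .ex (subst θ a)

/-- Replacement `ρ` applied to all the terms of a formula. -/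
def replace [DecidableEq F] (u c : F) (tl : List (Tm F V)) : Fm F R V → Fm F R V
  | .atom r ts => .atom r (ts.map (Tm.replace u c tl))
  | .top => .top
  | .bot => .bot
  | .and a b => .and (replace u c tl a) (replace u c tl b)
  | .or a b => .or (replace u c tl a) (replace u c tl b)
  | .imp a b => .imp (replace u c tl a) (replace u c tl b)
  | .all a => .all (replace u c tl a)
  | .ex a => .ex (replace u c tl a)

end Fm

namespace Tm

variable {F V : Type}

theorem subst_app (θ : V → Tm F V) (f : F) (ts : List (Tm F V)) :
    subst θ (.app f ts) = .app f (ts.map (subst θ)) := by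
  simp [subst]

theorem replace_app_of_ne_nil [DecidableEq F] (u c : F) (tl : List (Tm F V)) (f : F)
    {ts : List (Tm F V)} (hts : ts ≠ []) :
    replace u c tl (.app f ts) = .app f (ts.map (replace u c tl)) := by
  cases ts with
  | nil => exact absurd rfl hts
  | cons t ts => simp [replace]

theorem subst_eq_self (θ : V → Tm F V) :
    ∀ t : Tm F V, (∀ x, OccursVar x t → θ x = .fvar x) → subst θ t = t
  | .fvar x, h => by simpa [subst] using h x .fvar
  | .bvar n, _ => by simp [subst]
  | .app f ts, h => by
    rw [subst_app]
    have ih : ∀ t ∈ ts, subst θ t = id t := fun t ht =>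
      subst_eq_self θ t fun x hx => h x (.app ht hx)
    rw [List.map_congr_left ih, List.map_id]

theorem subst_replaceSubst_replace [DecidableEq F] (u c : F) (tl : List (Tm F V))
    (θ : V → Tm F V) (hdom : ∀ x ∈ domain θ, ∀ t ∈ tl, ¬ OccursVar x t) :
    ∀ t : Tm F V, subst (replaceSubst u c tl θ) (replace u c tl t) = replace u c tl (subst θ t)
  | .fvar x => by simp [subst, replace, replaceSubst]
  | .bvar n => by simp [subst, replace]
  | .app f [] => by
    by_cases hf : f = u
    · have htl : tl.map (subst (replaceSubst u c tl θ)) = tl := by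
        have hfix : ∀ t ∈ tl, subst (replaceSubst u c tl θ) t = id t := by
          refine fun t ht => subst_eq_self _ t fun x hx => ?_
          have hx' : θ x = .fvar x := by
            by_contra hne
            exact hdom x hne t ht hx
          simp [replaceSubst, hx', replace]
        rw [List.map_congr_left hfix, List.map_id]
      simp [subst_app, replace, hf, htl]
    · simp [subst_app, replace, hf]
  | .app f (s :: ts) => by
    have ih : ∀ t ∈ s :: ts,
        subst (replaceSubst u c tl θ) (replace u c tl t) = replace u c tl (subst θ t) :=
      fun t _ => subst_replaceSubst_replace u c tl θ hdom t
    rw [replace_app_of_ne_nil u c tl f (List.cons_ne_nil s ts), subst_app, subst_app,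
      replace_app_of_ne_nil u c tl f (by simp), List.map_map, List.map_map]
    exact congrArg (Tm.app f) (List.map_congr_left ih)

end Tm

/-- Let `θ` be a substitution whose domain contains no variable
occurring in any of the terms `t₁, …, tₙ` (the list `tl`).  Then for every
first-order formula `φ` over the signature, `ρ(θ)(ρ(φ)) = ρ(θ(φ))`, where
formulas are identified up to consistent capture-avoiding renaming of bound
variables (here: represented with de Bruijn quantifiers). -/
theorem replace_subst_distrib_formula {F R V : Type} [DecidableEq F]
    (u c : F) (tl : List (Tm F V)) (htl : ∀ t ∈ tl, Tm.LC t)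
    (θ : V → Tm F V) (hlc : ∀ x : V, Tm.LC (θ x))
    (hθ : Tm.IsSubst θ)
    (hdom : ∀ x ∈ Tm.domain θ, ∀ t ∈ tl, ¬ Tm.OccursVar x t) :
    ∀ φ : Fm F R V,
      Fm.subst (Tm.replaceSubst u c tl θ) (Fm.replace u c tl φ)
        = Fm.replace u c tl (Fm.subst θ φ) := by
  intro φ
  induction φ with
  | atom r ts =>
    simp [Fm.subst, Fm.replace, Tm.subst_replaceSubst_replace u c tl θ hdom]
  | top => rfl
  | bot => rfl
  | and a b iha ihb => simp [Fm.subst, Fm.replace, iha, ihb]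
  | or a b iha ihb => simp [Fm.subst, Fm.replace, iha, ihb]
  | imp a b iha ihb => simp [Fm.subst, Fm.replace, iha, ihb]
  | all a iha => simp [Fm.subst, Fm.replace, iha]
  | ex a iha => simp [Fm.subst, Fm.replace, iha]
end

section
/- Let s be a term in which the symbol c does not occur and in which no variable occurring in t₁, …, tₙ occurs. Then ι(ρ(s)) = s; that is, the inversion operation undoes the replacement of u by c(t₁, …, tₙ). -/
theorem FOTerm.replace_app_of_ne_nil {F V : Type} [DecidableEq F]
    (u c : F) (tl : List (FOTerm F V)) (f : F) {ts : List (FOTerm F V)} (h : ts ≠ []) :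
    FOTerm.replace u c tl (.app f ts) = .app f (ts.map (FOTerm.replace u c tl)) := by
  rw [FOTerm.replace, List.attach_map_val]
  exact h

theorem FOTerm.invert_app_of_ne {F V : Type} [DecidableEq F]
    (u : F) {c f : F} (h : f ≠ c) (ts : List (FOTerm F V)) :
    FOTerm.invert u c (.app f ts) = .app f (ts.map (FOTerm.invert u c)) := by
  rw [FOTerm.invert, if_neg h, List.attach_map_val]

/-- Inversion undoes replacement on terms in which `c` does not occur. -/
theorem FOTerm.invert_replace_of_not_occursFn {F V : Type} [DecidableEq F]
    (u c : F) (tl : List (FOTerm F V)) :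
    ∀ s : FOTerm F V, ¬ FOTerm.OccursFn c s →
      FOTerm.invert u c (FOTerm.replace u c tl s) = s
  | .var x, _ => by simp [FOTerm.replace, FOTerm.invert]
  | .app f [], hc => by
    have hf : f ≠ c := fun h => hc (h ▸ .head)
    by_cases hu : f = u <;> simp [FOTerm.replace, FOTerm.invert, hu]
    exact fun h => absurd h hf
  | .app f (t :: ts), hc => by
    have hf : f ≠ c := fun h => hc (h ▸ .head)
    have ih : ∀ r ∈ t :: ts, FOTerm.invert u c (FOTerm.replace u c tl r) = r := fun r hr =>
      FOTerm.invert_replace_of_not_occursFn u c tl r fun h => hc (.arg hr h)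
    rw [FOTerm.replace_app_of_ne_nil u c tl f (List.cons_ne_nil t ts),
      FOTerm.invert_app_of_ne u hf, List.map_map, FOTerm.app.injEq]
    exact ⟨rfl, (List.map_congr_left ih).trans (List.map_id _)⟩

/-- Let `s` be a term in which the symbol `c` does not occur and
in which no variable occurring in `t₁, …, tₙ` (the list `tl`) occurs.  Then
`ι(ρ(s)) = s`: the inversion undoes the replacement of `u` by `c(t₁, …, tₙ)`. -/
theorem invert_replace {F V : Type} [DecidableEq F]
    (u c : F) (tl : List (FOTerm F V)) (s : FOTerm F V)
    (hc : ¬ FOTerm.OccursFn c s)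
    (hvars : ∀ x : V, (∃ t ∈ tl, FOTerm.OccursVar x t) → ¬ FOTerm.OccursVar x s) :
    FOTerm.invert u c (FOTerm.replace u c tl s) = s :=
  FOTerm.invert_replace_of_not_occursFn u c tl s hc
end

section
/- Let U be a unification problem such that the symbol c does not occur in any term of U and no variable occurring in t₁, …, tₙ occurs in any term of U. If a substitution θ unifies ρ(U), then ι(θ) unifies U. -/
namespace FOTerm

theorem replace_app {F V : Type} [DecidableEq F] (u c : F) (tl : List (FOTerm F V))
    (f : F) {ts : List (FOTerm F V)} (hts : ts ≠ []) :
    replace u c tl (.app f ts) = .app f (ts.map (replace u c tl)) := by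
  cases ts with
  | nil => exact absurd rfl hts
  | cons t ts => simp [replace]

theorem invert_app {F V : Type} [DecidableEq F] (u : F) {c f : F} (hf : f ≠ c)
    (ts : List (FOTerm F V)) :
    invert u c (.app f ts) = .app f (ts.map (invert u c)) := by
  simp [invert, hf]

/-- Inversion undoes replacement after a substitution, on terms in which `c` does not occur. -/
theorem invert_subst_replace {F V : Type} [DecidableEq F] (u c : F) (tl : List (FOTerm F V))
    (θ : V → FOTerm F V) :
    ∀ s : FOTerm F V, ¬ OccursFn c s →
      invert u c (subst θ (replace u c tl s)) = subst (invertSubst u c θ) s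
  | .var x, _ => by simp [replace, subst, invertSubst]
  | .app f ts, hs => by
    have hf : f ≠ c := by
      rintro rfl
      exact hs .head
    by_cases hts : ts = []
    · subst hts
      by_cases hu : f = u
      · simp [replace, hu, subst_app, invert]
      · simp [replace, hu, subst_app, invert_app u hf]
    · rw [replace_app u c tl f hts, subst_app, invert_app u hf, subst_app]
      simp only [List.map_map, FOTerm.app.injEq, true_and]
      refine List.map_congr_left fun t ht => ?_
      exact invert_subst_replace u c tl θ t fun h => hs (.arg ht h)

end FOTerm

/-- Let `U` be a unification problem in which the symbol `c`
does not occur and in which no variable occurring in `t₁, …, tₙ` (the list `tl`)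
occurs.  If a substitution `θ` unifies `ρ(U)`, then `ι(θ)` unifies `U`. -/
theorem invert_unifies {F V : Type} [DecidableEq F]
    (u c : F) (tl : List (FOTerm F V))
    (U : Set (FOTerm F V × FOTerm F V)) (hU : U.Finite)
    (hc : ∀ p ∈ U, ¬ FOTerm.OccursFn c p.1 ∧ ¬ FOTerm.OccursFn c p.2)
    (hvars : ∀ x : V, (∃ t ∈ tl, FOTerm.OccursVar x t) →
      ∀ p ∈ U, ¬ FOTerm.OccursVar x p.1 ∧ ¬ FOTerm.OccursVar x p.2)
    (θ : V → FOTerm F V) (hθ : FOTerm.IsSubst θ)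
    (hunif : FOTerm.Unifies θ (FOTerm.mapProb (FOTerm.replace u c tl) U)) :
    FOTerm.Unifies (FOTerm.invertSubst u c θ) U := by
  intro p hp
  have h : FOTerm.subst θ (FOTerm.replace u c tl p.1) =
      FOTerm.subst θ (FOTerm.replace u c tl p.2) := hunif _ ⟨p, hp, rfl⟩
  rw [← FOTerm.invert_subst_replace u c tl θ p.1 (hc p hp).1,
    ← FOTerm.invert_subst_replace u c tl θ p.2 (hc p hp).2, h]
end
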